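/- Under Assumptions A1–A4 and the stated conditions on h and Γ, for every p ∈ (0, p̌] there exists a constant C > 0, depending only on p, T, τ, r, ξ, L₀ and the constants in Assumptions A1–A4 (but not on Δ or t), such that for every admissible step size Δ ∈ (0,1] and every t ∈ [0, T]: E|χ(t)|^p ≤ C, where χ is the continuous version of the truncated Euler–Maruyama scheme. -/

import Mathlib

open MeasureTheory ProbabilityTheory

theorem Real.ringChoose_two (a : ℝ) : Ring.choose a 2 = a * (a - 1) / 2 := by
  have h := Ring.descPochhammer_eq_factorial_smul_choose a 2
  simp [descPochhammer, Polynomial.smeval_X, Polynomial.smeval_mul, Polynomial.smeval_sub, Polynomial.smeval_one, pow_one] at h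
  linarith

/-- Fourth-order Taylor bound at the origin. -/
theorem Real.exists_one_add_rpow_sub_le_near_zero (a : ℝ) :
    ∃ c C δ : ℝ, 0 < δ ∧ 0 ≤ C ∧ ∀ z : ℝ, |z| < δ →
      (1 + z) ^ a ≤ 1 + a * z + a * (a - 1) / 2 * z ^ 2 + c * z ^ 3 + C * z ^ 4 := by
  have h := (Real.one_add_rpow_hasFPowerSeriesAt_zero (a := a)).isBigO_sub_partialSum_pow 4
  obtain ⟨C, hC0, hC⟩ := h.exists_nonneg
  rw [Asymptotics.IsBigOWith, Metric.eventually_nhds_iff] at hC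
  obtain ⟨δ, hδ, hC⟩ := hC
  refine ⟨Ring.choose a 3, C, δ, hδ, hC0, fun z hz => ?_⟩
  have := hC (y := z) (by simpa using hz)
  simp [FormalMultilinearSeries.partialSum, Finset.sum_range_succ, Real.ringChoose_two,
    -FormalMultilinearSeries.apply_eq_prod_smul_coeff] at this
  have h4 : |z| ^ 4 = z ^ 4 := by rw [← abs_pow]; exact abs_of_nonneg (by positivity)
  rw [h4] at this
  linarith [(abs_le.1 this).2]

theorem Real.exists_one_add_rpow_le {q : ℝ} (hq : 0 ≤ q) :
    ∃ (c C : ℝ) (N : ℕ), 0 ≤ C ∧ 2 ≤ N ∧ ∀ z : ℝ, -1 ≤ z →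
      (1 + z) ^ q ≤ 1 + q * z + q * (q - 1) / 2 * z ^ 2 + c * z ^ 3
        + C * (z ^ 4 + z ^ (2 * N)) := by
  obtain ⟨c, C, δ, hδ, hC, H⟩ := Real.exists_one_add_rpow_sub_le_near_zero q
  obtain ⟨M, hM⟩ := exists_nat_ge q
  set K : ℝ := 2 + |q| + |q * (q - 1) / 2| + |c| with hK
  set D : ℝ := K * (1 / δ + 1) ^ (2 * (M + 2)) with hD
  have hD0 : 0 ≤ D := by positivity
  refine ⟨c, C + D, M + 2, by positivity, by omega, fun z hz => ?_⟩
  have hz4 : 0 ≤ z ^ 4 := by positivity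
  have hzN : 0 ≤ z ^ (2 * (M + 2)) := by rw [pow_mul]; positivity
  rcases lt_or_ge |z| δ with hlt | hge
  · have := H z hlt
    nlinarith [mul_nonneg hD0 hz4, mul_nonneg hD0 hzN, mul_nonneg hC hzN]
  · have h1 : (1 + z) ^ q ≤ (1 + |z|) ^ (2 * (M + 2)) := by
      calc (1 + z) ^ q ≤ (1 + |z|) ^ q :=
            Real.rpow_le_rpow (by linarith) (by linarith [le_abs_self z]) hq
        _ ≤ (1 + |z|) ^ ((2 * (M + 2) : ℕ) : ℝ) := by
            apply Real.rpow_le_rpow_of_exponent_le (by linarith [abs_nonneg z])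
            push_cast; linarith
        _ = _ := Real.rpow_natCast _ _
    have hpow : ∀ k : ℕ, k ≤ 3 → |z| ^ k ≤ (1 + |z|) ^ (2 * (M + 2)) := fun k hk =>
      calc |z| ^ k ≤ (1 + |z|) ^ k := by gcongr; linarith
        _ ≤ _ := pow_le_pow_right₀ (by linarith [abs_nonneg z]) (by omega)
    have h2 : (1 + |z|) ^ (2 * (M + 2)) ≤ (1 / δ + 1) ^ (2 * (M + 2)) * z ^ (2 * (M + 2)) := by
      have : z ^ (2 * (M + 2)) = |z| ^ (2 * (M + 2)) := by rw [pow_mul, pow_mul, sq_abs]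
      rw [this, ← mul_pow]
      gcongr
      have : 1 ≤ 1 / δ * |z| := by rw [one_div, ← div_eq_inv_mul, le_div_iff₀ hδ]; linarith
      linarith
    have hterm : ∀ (b : ℝ) (k : ℕ), k ≤ 3 → -(|b| * (1 + |z|) ^ (2 * (M + 2))) ≤ b * z ^ k := by
      intro b k hk
      have := mul_le_mul_of_nonneg_left (hpow k hk) (abs_nonneg b)
      rw [← abs_pow, ← abs_mul] at this
      linarith [neg_abs_le (b * z ^ k)]
    have t1 := hterm q 1 (by norm_num)
    have t2 := hterm (q * (q - 1) / 2) 2 (by norm_num)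
    have t3 := hterm c 3 (by norm_num)
    have t0 := hpow 0 (by norm_num)
    rw [pow_one] at t1
    have : K * (1 + |z|) ^ (2 * (M + 2)) ≤ D * z ^ (2 * (M + 2)) := by
      rw [hD, mul_assoc]; gcongr
    rw [hK] at this
    nlinarith [mul_nonneg hD0 hz4, mul_nonneg hC hz4, mul_nonneg hC hzN]

theorem Real.exists_symm_one_add_rpow_le {q : ℝ} (hq : 1 ≤ q) :
    ∃ (C : ℝ) (n : ℕ), 0 ≤ C ∧ 2 ≤ n ∧ ∀ b t : ℝ, b ^ 2 ≤ 1 →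
      (1 + (t ^ 2 + 2 * b * t)) ^ q + (1 + (t ^ 2 - 2 * b * t)) ^ q
        ≤ 2 + 2 * (q * (2 * q - 1)) * t ^ 2 + C * (t ^ 4 + t ^ (2 * n)) := by
  obtain ⟨c, C, N, hC, hN, H⟩ := Real.exists_one_add_rpow_le (by linarith : 0 ≤ q)
  have key : ∀ b t : ℝ, b ^ 2 ≤ 1 → ∀ m : ℕ, 2 ≤ m → m ≤ N →
      (t ^ 2 + 2 * b * t) ^ (2 * m) ≤ 2 ^ (6 * N) * (t ^ 4 + t ^ (2 * (2 * N))) := by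
    intro b t hb m hm hmN
    have hb1 : |b| ≤ 1 := by rwa [sq_le_one_iff_abs_le_one] at hb
    have h1 : |t ^ 2 + 2 * b * t| ≤ |t| ^ 2 + 2 * |t| := by
      refine (abs_add_le _ _).trans ?_
      rw [abs_mul, abs_mul, abs_pow, abs_two]
      nlinarith [abs_nonneg t]
    have h2 : (t ^ 2 + 2 * b * t) ^ (2 * m) ≤ (|t| ^ 2 + 2 * |t|) ^ (2 * m) := by
      rw [← (even_two_mul m).pow_abs]; gcongr
    refine h2.trans ?_
    have e4 : t ^ 4 = |t| ^ 4 := by rw [(by decide : Even 4).pow_abs]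
    have eN : t ^ (2 * (2 * N)) = |t| ^ (2 * (2 * N)) := by rw [(even_two_mul _).pow_abs]
    rw [e4, eN]
    have ht := abs_nonneg t
    generalize |t| = s at *
    rcases le_total s 1 with hs | hs
    · calc (s ^ 2 + 2 * s) ^ (2 * m) ≤ (4 * s) ^ (2 * m) := by gcongr; nlinarith
        _ = 4 ^ (2 * m) * s ^ (2 * m) := mul_pow _ _ _
        _ ≤ 2 ^ (6 * N) * s ^ 4 := by
            apply mul_le_mul
            · rw [show (4 : ℝ) = 2 ^ 2 by norm_num, ← pow_mul]
              exact pow_le_pow_right₀ (by norm_num) (by omega)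
            · exact pow_le_pow_of_le_one ht hs (by omega)
            · positivity
            · positivity
        _ ≤ _ := by gcongr; linarith [pow_nonneg ht (2 * (2 * N))]
    · calc (s ^ 2 + 2 * s) ^ (2 * m) ≤ (4 * s ^ 2) ^ (2 * m) := by gcongr; nlinarith
        _ = 4 ^ (2 * m) * s ^ (2 * (2 * m)) := by rw [mul_pow, ← pow_mul]
        _ ≤ 2 ^ (6 * N) * s ^ (2 * (2 * N)) := by
            apply mul_le_mul
            · rw [show (4 : ℝ) = 2 ^ 2 by norm_num, ← pow_mul]
              exact pow_le_pow_right₀ (by norm_num) (by omega)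
            · exact pow_le_pow_right₀ hs (by omega)
            · positivity
            · positivity
        _ ≤ _ := by gcongr; linarith [pow_nonneg ht 4]
  refine ⟨q * (q - 1) + 26 * |c| * 2 + C * (4 * 2 ^ (6 * N)), 2 * N, ?_, by omega, ?_⟩
  · have : 0 ≤ q * (q - 1) := mul_nonneg (by linarith) (by linarith)
    positivity
  intro b t hb
  have hb1 : |b| ≤ 1 := by rwa [sq_le_one_iff_abs_le_one] at hb
  have hm1 : -1 ≤ t ^ 2 + 2 * b * t := by nlinarith [sq_nonneg (t + b)]
  have hm2 : -1 ≤ t ^ 2 + 2 * (-b) * t := by nlinarith [sq_nonneg (t - b)]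
  have i1 := H _ hm1
  have i2 := H _ hm2
  have k1 : (t ^ 2 + 2 * b * t) ^ 4 ≤ _ := key b t hb 2 le_rfl hN
  have k2 := key b t hb N hN le_rfl
  have k3 : (t ^ 2 + 2 * (-b) * t) ^ 4 ≤ _ := key (-b) t (by simpa using hb) 2 le_rfl hN
  have k4 := key (-b) t (by simpa using hb) N hN le_rfl
  have e2 : t ^ 2 - 2 * b * t = t ^ 2 + 2 * (-b) * t := by ring
  rw [e2]
  set S := t ^ 4 + t ^ (2 * (2 * N)) with hS
  have hz1 : C * ((t ^ 2 + 2 * b * t) ^ 4 + (t ^ 2 + 2 * b * t) ^ (2 * N))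
      ≤ C * (2 * (2 ^ (6 * N) * S)) := by gcongr; linarith
  have hz2 : C * ((t ^ 2 + 2 * (-b) * t) ^ 4 + (t ^ 2 + 2 * (-b) * t) ^ (2 * N))
      ≤ C * (2 * (2 ^ (6 * N) * S)) := by gcongr; linarith
  have hp : 0 ≤ t ^ (2 * (2 * N)) := by rw [pow_mul]; positivity
  have t6 : t ^ 6 ≤ S := by
    rcases le_total (t ^ 2) 1 with hs | hs
    · have : t ^ 6 ≤ t ^ 4 := by nlinarith [sq_nonneg (t ^ 2)]
      linarith
    · have : (t ^ 2) ^ 3 ≤ (t ^ 2) ^ (2 * N) := pow_le_pow_right₀ hs (by omega)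
      rw [← pow_mul, ← pow_mul] at this
      norm_num only at this
      have : 0 ≤ t ^ 4 := by positivity
      linarith
  have t4 : t ^ 4 ≤ S := by linarith
  have t4' : 0 ≤ t ^ 4 := by positivity
  have cub : c * (t ^ 2 + 2 * b * t) ^ 3 + c * (t ^ 2 + 2 * (-b) * t) ^ 3 ≤ 26 * |c| * 2 * S := by
    have : c * (t ^ 2 + 2 * b * t) ^ 3 + c * (t ^ 2 + 2 * (-b) * t) ^ 3
        = c * (2 * t ^ 6 + 24 * b ^ 2 * t ^ 4) := by ring
    rw [this]
    have h0 : 0 ≤ 2 * t ^ 6 + 24 * b ^ 2 * t ^ 4 := by positivity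
    have h1 : 2 * t ^ 6 + 24 * b ^ 2 * t ^ 4 ≤ 26 * S := by nlinarith
    have h2 := mul_le_mul_of_nonneg_right (le_abs_self c) h0
    have h3 := mul_le_mul_of_nonneg_left h1 (abs_nonneg c)
    have h4 : 0 ≤ |c| * S := mul_nonneg (abs_nonneg _) (by linarith)
    linarith
  have hqq : 0 ≤ q * (q - 1) := mul_nonneg (by linarith) (by linarith)
  have quad : q * (q - 1) / 2 * (t ^ 2 + 2 * b * t) ^ 2
      + q * (q - 1) / 2 * (t ^ 2 + 2 * (-b) * t) ^ 2 ≤ q * (q - 1) * S + 4 * (q * (q - 1)) * t ^ 2 := by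
    have : q * (q - 1) / 2 * (t ^ 2 + 2 * b * t) ^ 2
      + q * (q - 1) / 2 * (t ^ 2 + 2 * (-b) * t) ^ 2
        = q * (q - 1) * (t ^ 4 + 4 * b ^ 2 * t ^ 2) := by ring
    rw [this]
    have : t ^ 4 + 4 * b ^ 2 * t ^ 2 ≤ S + 4 * t ^ 2 := by nlinarith [sq_nonneg t]
    calc _ ≤ q * (q - 1) * (S + 4 * t ^ 2) := by gcongr
      _ = _ := by ring
  linear_combination i1 + i2 + hz1 + hz2 + cub + quad

/-- The symmetrised second-order expansion of `x ↦ (1 + x²) ^ q`. -/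
theorem Real.exists_symm_one_add_sq_rpow_le {q : ℝ} (hq : 1 ≤ q) :
    ∃ (C : ℝ) (n : ℕ), 0 ≤ C ∧ 2 ≤ n ∧ ∀ a s : ℝ,
      (1 + (a + s) ^ 2) ^ q + (1 + (a - s) ^ 2) ^ q
        ≤ 2 * (1 + a ^ 2) ^ q + 2 * (q * (2 * q - 1)) * s ^ 2 * (1 + a ^ 2) ^ (q - 1)
          + C * (1 + a ^ 2) ^ q * (s ^ 4 + s ^ (2 * n)) := by
  obtain ⟨C, n, hC, hn, H⟩ := Real.exists_symm_one_add_rpow_le hq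
  refine ⟨C, n, hC, hn, fun a s => ?_⟩
  set u := 1 + a ^ 2 with hu
  have hu1 : 1 ≤ u := by nlinarith [sq_nonneg a]
  have hu0 : 0 < u := by linarith
  have hr : Real.sqrt u ^ 2 = u := Real.sq_sqrt hu0.le
  have hr0 : 0 < Real.sqrt u := Real.sqrt_pos.2 hu0
  set ρ := Real.sqrt u
  have hb : (a / ρ) ^ 2 ≤ 1 := by
    rw [div_pow, hr, div_le_one hu0]; linarith
  have h := mul_le_mul_of_nonneg_left (H (a / ρ) (s / ρ) hb) (Real.rpow_nonneg hu0.le q)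
  have hst : ∀ k : ℕ, (s / ρ) ^ (2 * k) ≤ s ^ (2 * k) := by
    intro k
    rw [pow_mul, pow_mul, div_pow, hr]
    gcongr
    exact div_le_self (sq_nonneg s) hu1
  have f1 : 1 + (a + s) ^ 2 = u * (1 + ((s / ρ) ^ 2 + 2 * (a / ρ) * (s / ρ))) := by
    have : ((s / ρ) ^ 2 + 2 * (a / ρ) * (s / ρ)) = (s ^ 2 + 2 * a * s) / u := by
      rw [← hr]; field_simp
    rw [this]; field_simp; rw [hu]; ring
  have f2 : 1 + (a - s) ^ 2 = u * (1 + ((s / ρ) ^ 2 - 2 * (a / ρ) * (s / ρ))) := by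
    have : ((s / ρ) ^ 2 - 2 * (a / ρ) * (s / ρ)) = (s ^ 2 - 2 * a * s) / u := by
      rw [← hr]; field_simp
    rw [this]; field_simp; rw [hu]; ring
  have n1 : 0 ≤ 1 + ((s / ρ) ^ 2 + 2 * (a / ρ) * (s / ρ)) := by nlinarith [sq_nonneg (s/ρ + a/ρ)]
  have n2 : 0 ≤ 1 + ((s / ρ) ^ 2 - 2 * (a / ρ) * (s / ρ)) := by nlinarith [sq_nonneg (s/ρ - a/ρ)]
  rw [f1, f2, Real.mul_rpow hu0.le n1, Real.mul_rpow hu0.le n2, ← mul_add]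
  refine h.trans ?_
  have h2 : (s / ρ) ^ 2 * u ^ q = s ^ 2 * u ^ (q - 1) := by
    rw [div_pow, hr, Real.rpow_sub_one hu0.ne']; field_simp
  have h4 : (s / ρ) ^ 4 + (s / ρ) ^ (2 * n) ≤ s ^ 4 + s ^ (2 * n) := add_le_add (hst 2) (hst n)
  have h5 : C * u ^ q * ((s / ρ) ^ 4 + (s / ρ) ^ (2 * n)) ≤ C * u ^ q * (s ^ 4 + s ^ (2 * n)) := by
    gcongr
  linear_combination h5 + 2 * (q * (2 * q - 1)) * h2

/-- Bernoulli's inequality in the form `u^q + q v u^(q-1) ≤ (u + v)^q`. -/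
theorem Real.rpow_add_mul_rpow_le {q u v : ℝ} (hq : 1 ≤ q) (hu : 0 < u) (hv : 0 ≤ v) :
    u ^ q + q * v * u ^ (q - 1) ≤ (u + v) ^ q := by
  have h := one_add_mul_self_le_rpow_one_add (s := v / u) (by have := div_nonneg hv hu.le; linarith) hq
  have h2 := mul_le_mul_of_nonneg_left h (Real.rpow_nonneg hu.le q)
  rw [← Real.mul_rpow hu.le (by positivity)] at h2
  have e : u * (1 + v / u) = u + v := by field_simp
  rw [e] at h2
  rw [Real.rpow_sub_one hu.ne']
  calc _ = u ^ q * (1 + q * (v / u)) := by field_simp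
    _ ≤ _ := h2

theorem ProbabilityTheory.integrable_pow_gaussianReal (n : ℕ) (m : ℝ) (v : NNReal) :
    Integrable (fun z : ℝ => z ^ n) (gaussianReal m v) := by
  have h := (memLp_id_gaussianReal' (μ := m) (v := v) (n : ENNReal) (by simp)).integrable_norm_pow'
  rw [← integrable_norm_iff (by fun_prop)]
  simpa [norm_pow] using h

theorem ProbabilityTheory.integral_sq_stdGaussian : ∫ z, z ^ 2 ∂gaussianReal 0 1 = 1 := by
  have h := variance_id_gaussianReal (μ := 0) (v := 1)
  rw [variance_eq_integral (by fun_prop)] at h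
  simpa using h

theorem ProbabilityTheory.exists_lintegral_one_add_sq_rpow_gaussianReal_le {q : ℝ} (hq : 1 ≤ q)
    {D : ℝ} (hD : 0 ≤ D) :
    ∃ C : ℝ, 0 ≤ C ∧ ∀ a g δ : ℝ, 0 ≤ δ → g ^ 2 * δ ≤ D ^ 2 → g ^ 4 * δ ≤ D ^ 4 →
      ∫⁻ w, ENNReal.ofReal ((1 + (a + g * w) ^ 2) ^ q) ∂gaussianReal 0 δ.toNNReal
        ≤ ENNReal.ofReal ((1 + C * δ) * (1 + a ^ 2 + (2 * q - 1) * (g ^ 2 * δ)) ^ q) := by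
  obtain ⟨C, n, hC, hn, H⟩ := Real.exists_symm_one_add_sq_rpow_le hq
  set m4 : ℝ := ∫ z, z ^ 4 ∂gaussianReal 0 1
  set mn : ℝ := ∫ z, z ^ (2 * n) ∂gaussianReal 0 1
  have hm4 : 0 ≤ m4 := integral_nonneg fun z => by positivity
  have hmn : 0 ≤ mn := integral_nonneg fun z => by simp only [pow_mul]; positivity
  refine ⟨C * (D ^ 4 * m4 + D ^ (2 * n) * mn), by positivity, fun a g δ hδ h2 h4 => ?_⟩
  have hmap : gaussianReal 0 δ.toNNReal = (gaussianReal 0 1).map (fun z => Real.sqrt δ * z) := by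
    rw [gaussianReal_map_const_mul]
    congr 1
    · simp
    · ext; simp [Real.sq_sqrt hδ, hδ]
  rw [hmap, lintegral_map (by fun_prop) (by fun_prop)]
  set s := g * Real.sqrt δ with hs
  have hs2 : s ^ 2 = g ^ 2 * δ := by rw [hs, mul_pow, Real.sq_sqrt hδ]
  have hsz : ∀ z, a + g * (Real.sqrt δ * z) = a + s * z := fun z => by rw [hs]; ring
  simp_rw [hsz]
  set I := ∫⁻ z, ENNReal.ofReal ((1 + (a + s * z) ^ 2) ^ q) ∂gaussianReal 0 1 with hI
  have hI' : I = ∫⁻ z, ENNReal.ofReal ((1 + (a - s * z) ^ 2) ^ q) ∂gaussianReal 0 1 := by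
    have hneg : gaussianReal 0 1 = (gaussianReal 0 1).map (fun z : ℝ => -z) := by
      rw [gaussianReal_map_neg, neg_zero]
    rw [hI]
    conv_lhs => rw [hneg]
    rw [lintegral_map (by fun_prop) (by fun_prop)]
    simp [sub_eq_add_neg]
  set u := 1 + a ^ 2 with hu
  have hu0 : 0 < u := by positivity
  set R := (1 + C * (D ^ 4 * m4 + D ^ (2 * n) * mn) * δ) * (u + (2 * q - 1) * (g ^ 2 * δ)) ^ q
  suffices h : I + I ≤ ENNReal.ofReal (2 * R) by
    rw [← two_mul, ENNReal.ofReal_mul (by norm_num), ENNReal.ofReal_ofNat] at h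
    exact (ENNReal.mul_le_mul_iff_right (by norm_num) (by norm_num)).1 h
  have hP : ∀ z : ℝ, (1 + (a + s * z) ^ 2) ^ q + (1 + (a - s * z) ^ 2) ^ q
      ≤ 2 * u ^ q + (2 * (q * (2 * q - 1)) * s ^ 2 * u ^ (q - 1)) * z ^ 2
        + ((C * u ^ q * s ^ 4) * z ^ 4 + (C * u ^ q * s ^ (2 * n)) * z ^ (2 * n)) := by
    intro z
    have := H a (s * z)
    simp only [mul_pow] at this
    linarith
  have i0 : Integrable (fun _ : ℝ => 2 * u ^ q) (gaussianReal 0 1) := integrable_const _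
  have i2 := (integrable_pow_gaussianReal 2 0 1).const_mul (2 * (q * (2 * q - 1)) * s ^ 2 * u ^ (q - 1))
  have i4 := (integrable_pow_gaussianReal 4 0 1).const_mul (C * u ^ q * s ^ 4)
  have i5 := (integrable_pow_gaussianReal (2 * n) 0 1).const_mul (C * u ^ q * s ^ (2 * n))
  have i02 : Integrable (fun z : ℝ => 2 * u ^ q
      + 2 * (q * (2 * q - 1)) * s ^ 2 * u ^ (q - 1) * z ^ 2) (gaussianReal 0 1) := i0.add i2
  have i45 : Integrable (fun z : ℝ => C * u ^ q * s ^ 4 * z ^ 4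
      + C * u ^ q * s ^ (2 * n) * z ^ (2 * n)) (gaussianReal 0 1) := i4.add i5
  calc I + I = ∫⁻ z, (ENNReal.ofReal ((1 + (a + s * z) ^ 2) ^ q)
        + ENNReal.ofReal ((1 + (a - s * z) ^ 2) ^ q)) ∂gaussianReal 0 1 := by
        rw [lintegral_add_left (by fun_prop), ← hI, ← hI']
    _ ≤ ∫⁻ z, ENNReal.ofReal (2 * u ^ q + (2 * (q * (2 * q - 1)) * s ^ 2 * u ^ (q - 1)) * z ^ 2
        + ((C * u ^ q * s ^ 4) * z ^ 4 + (C * u ^ q * s ^ (2 * n)) * z ^ (2 * n)))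
          ∂gaussianReal 0 1 := by
        refine lintegral_mono fun z => ?_
        rw [← ENNReal.ofReal_add (by positivity) (by positivity)]
        exact ENNReal.ofReal_le_ofReal (hP z)
    _ = ENNReal.ofReal (∫ z, (2 * u ^ q + (2 * (q * (2 * q - 1)) * s ^ 2 * u ^ (q - 1)) * z ^ 2
        + ((C * u ^ q * s ^ 4) * z ^ 4 + (C * u ^ q * s ^ (2 * n)) * z ^ (2 * n)))
          ∂gaussianReal 0 1) := by
        refine (ofReal_integral_eq_lintegral_ofReal (i02.add i45) ?_).symm
        exact Filter.Eventually.of_forall fun z => le_trans (by positivity) (hP z)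
    _ ≤ ENNReal.ofReal (2 * R) := by
        refine ENNReal.ofReal_le_ofReal ?_
        rw [integral_add i02 i45, integral_add i0 i2, integral_add i4 i5,
          integral_const_mul, integral_const_mul, integral_const_mul, integral_const_mul,
          integral_sq_stdGaussian]
        simp only [integral_const, probReal_univ, smul_eq_mul, one_mul, mul_one]
        have hb := Real.rpow_add_mul_rpow_le hq hu0
          (v := (2 * q - 1) * (g ^ 2 * δ)) (mul_nonneg (by linarith) (by positivity))
        have hv : 0 ≤ (2 * q - 1) * (g ^ 2 * δ) := mul_nonneg (by linarith) (by positivity)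
        have hmonoq : u ^ q ≤ (u + (2 * q - 1) * (g ^ 2 * δ)) ^ q :=
          Real.rpow_le_rpow hu0.le (by linarith) (by linarith)
        have hs4 : s ^ 4 ≤ D ^ 4 * δ := by
          have : s ^ 4 = g ^ 4 * δ * δ := by
            rw [show s ^ 4 = (s ^ 2) ^ 2 by ring, hs2]; ring
          rw [this]; gcongr
        have hsn : s ^ (2 * n) ≤ D ^ (2 * n) * δ := by
          obtain ⟨k, rfl⟩ := Nat.exists_eq_add_of_le hn
          have h5 : s ^ (2 * (2 + k)) = s ^ 4 * (s ^ 2) ^ k := by ring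
          have h6 : D ^ (2 * (2 + k)) * δ = D ^ 4 * δ * (D ^ 2) ^ k := by ring
          rw [h5, h6]
          have hsk : (s ^ 2) ^ k ≤ (D ^ 2) ^ k :=
            pow_le_pow_left₀ (sq_nonneg s) (hs2.le.trans h2) k
          exact mul_le_mul hs4 hsk (by positivity) (by positivity)
        have hE : C * u ^ q * s ^ 4 * m4 + C * u ^ q * s ^ (2 * n) * mn
            ≤ C * (D ^ 4 * m4 + D ^ (2 * n) * mn) * δ * (u + (2 * q - 1) * (g ^ 2 * δ)) ^ q := by
          have hh : C * u ^ q * s ^ 4 * m4 + C * u ^ q * s ^ (2 * n) * mn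
            ≤ C * u ^ q * (D ^ 4 * δ) * m4 + C * u ^ q * (D ^ (2 * n) * δ) * mn := by gcongr
          refine hh.trans ?_
          have : C * u ^ q * (D ^ 4 * δ) * m4 + C * u ^ q * (D ^ (2 * n) * δ) * mn
            = C * (D ^ 4 * m4 + D ^ (2 * n) * mn) * δ * u ^ q := by ring
          rw [this]
          gcongr
        have hE0 : 0 ≤ C * (D ^ 4 * m4 + D ^ (2 * n) * mn) * δ
            * (u + (2 * q - 1) * (g ^ 2 * δ)) ^ q := by
          have : 0 ≤ (u + (2 * q - 1) * (g ^ 2 * δ)) ^ q := Real.rpow_nonneg (by linarith) _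
          positivity
        rw [hs2]
        linear_combination 2 * hb + hE + hE0

/-- Integrating out an independent Gaussian increment. -/
theorem ProbabilityTheory.lintegral_one_add_sq_rpow_add_mul_le {Ω : Type*} [MeasurableSpace Ω]
    {μ : Measure Ω} [IsProbabilityMeasure μ] {q δ : ℝ} {A G W : Ω → ℝ} {F : ℝ → ℝ → ENNReal}
    (hA : Measurable A) (hG : Measurable G) (hW : Measurable W)
    (hind : IndepFun (fun ω => (A ω, G ω)) W μ)
    (hlaw : μ.map W = gaussianReal 0 δ.toNNReal)
    (hF : ∀ ω, ∫⁻ w, ENNReal.ofReal ((1 + (A ω + G ω * w) ^ 2) ^ q) ∂gaussianReal 0 δ.toNNReal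
      ≤ F (A ω) (G ω)) :
    ∫⁻ ω, ENNReal.ofReal ((1 + (A ω + G ω * W ω) ^ 2) ^ q) ∂μ ≤ ∫⁻ ω, F (A ω) (G ω) ∂μ := by
  have h := (indepFun_iff_map_prod_eq_prod_map_map (hA.prodMk hG).aemeasurable hW.aemeasurable).1 hind
  set Φ : (ℝ × ℝ) × ℝ → ENNReal :=
    fun x => ENNReal.ofReal ((1 + (x.1.1 + x.1.2 * x.2) ^ 2) ^ q) with hΦ
  have hΦm : Measurable Φ := by fun_prop
  calc ∫⁻ ω, ENNReal.ofReal ((1 + (A ω + G ω * W ω) ^ 2) ^ q) ∂μ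
      = ∫⁻ x, Φ x ∂(μ.map fun ω => ((A ω, G ω), W ω)) := by
        rw [lintegral_map hΦm ((hA.prodMk hG).prodMk hW)]
    _ = ∫⁻ y, ∫⁻ w, Φ (y, w) ∂gaussianReal 0 δ.toNNReal ∂(μ.map fun ω => (A ω, G ω)) := by
        rw [h, hlaw, lintegral_prod _ hΦm.aemeasurable]
    _ = ∫⁻ ω, ∫⁻ w, Φ ((A ω, G ω), w) ∂gaussianReal 0 δ.toNNReal ∂μ := by
        rw [lintegral_map hΦm.lintegral_prod_right' (hA.prodMk hG)]
    _ ≤ _ := lintegral_mono hF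

theorem one_add_sq_drift_le {q L D δ x f₁ f₂ g S : ℝ} (hδ0 : 0 ≤ δ) (hδ1 : δ ≤ 1)
    (hcoer : x * f₁ + (2 * q - 1) / 2 * g ^ 2 ≤ 2 * L * (1 + x ^ 2))
    (hf₁ : f₁ ^ 2 * δ ≤ 4 * D ^ 2) (hf₂ : f₂ ^ 2 ≤ S) :
    1 + (x + (f₁ + f₂) * δ) ^ 2 + (2 * q - 1) * (g ^ 2 * δ)
      ≤ (1 + (4 * L + 1 + 8 * D ^ 2) * δ) * (1 + x ^ 2) + 3 * δ * S := by
  have e1 := mul_le_mul_of_nonneg_left hcoer hδ0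
  have e2 : 0 ≤ δ * (x - f₂) ^ 2 := by positivity
  have e3 : 0 ≤ δ ^ 2 * (f₁ - f₂) ^ 2 := by positivity
  have e4 := mul_le_mul_of_nonneg_left hf₁ hδ0
  have e5 := mul_le_mul_of_nonneg_left hf₂ hδ0
  have e6 : δ ^ 2 * f₂ ^ 2 ≤ δ * f₂ ^ 2 := by
    have : δ ^ 2 ≤ δ := by nlinarith
    gcongr
  have e7 : 0 ≤ D ^ 2 * δ * x ^ 2 := by positivity
  linear_combination 2 * e1 + e2 + e3 + 2 * e4 + 3 * e5 + 2 * e6 + 8 * e7 + hδ0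

theorem rpow_weighted_sum_le {r : ℕ} {q c δ y₀ : ℝ} {y : Fin r → ℝ} (hq : 1 ≤ q) (hc : 0 ≤ c)
    (hδ : 0 ≤ δ) (hy₀ : 0 ≤ y₀) (hy : ∀ v, 0 ≤ y v) :
    ((1 + c * δ) * y₀ + c * δ * ∑ v, y v) ^ q
      ≤ (1 + c * (1 + r) * δ) ^ (q - 1) * ((1 + c * δ) * y₀ ^ q + c * δ * ∑ v, y v ^ q) := by
  set w : ℝ := 1 + c * (1 + r) * δ with hw
  have hw0 : 0 < w := by positivity
  have hcδ : 0 ≤ c * δ := by positivity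
  have h := Real.rpow_arith_mean_le_arith_mean_rpow (Finset.univ : Finset (Option (Fin r)))
    (fun i => (Option.elim i (1 + c * δ) (fun _ => c * δ)) / w) (fun i => Option.elim i y₀ y)
    (by rintro (_ | v) - <;> simp <;> positivity)
    (by
      simp [Fintype.sum_option]
      field_simp
      rw [hw]; ring)
    (by rintro (_ | v) - <;> simp [hy₀, hy]) hq
  simp only [Fintype.sum_option, Option.elim_none, Option.elim_some] at h
  have e1 : (1 + c * δ) / w * y₀ + ∑ x, c * δ / w * y x
      = ((1 + c * δ) * y₀ + c * δ * ∑ v, y v) / w := by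
    rw [← Finset.mul_sum]; field_simp
  have e2 : (1 + c * δ) / w * y₀ ^ q + ∑ x, c * δ / w * y x ^ q
      = ((1 + c * δ) * y₀ ^ q + c * δ * ∑ v, y v ^ q) / w := by
    rw [← Finset.mul_sum]; field_simp
  have hs : 0 ≤ ∑ v, y v := Finset.sum_nonneg fun v _ => hy v
  rw [e1, e2, Real.div_rpow (by positivity) hw0.le, div_le_iff₀ (by positivity)] at h
  refine h.trans (le_of_eq ?_)
  rw [Real.rpow_sub_one hw0.ne']
  field_simp

theorem lintegral_weighted_sum_le {Ω : Type*} [MeasurableSpace Ω] {μ : Measure Ω} {r : ℕ}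
    {a b K : ℝ} {y₀ : Ω → ℝ} {y : Fin r → Ω → ℝ} (ha : 0 ≤ a) (hb : 0 ≤ b) (hK : 0 ≤ K)
    (hm₀ : Measurable y₀) (hm : ∀ v, Measurable (y v))
    (hy₀ : ∀ ω, 0 ≤ y₀ ω) (hy : ∀ v ω, 0 ≤ y v ω)
    (h₀ : ∫⁻ ω, ENNReal.ofReal (y₀ ω) ∂μ ≤ ENNReal.ofReal K)
    (h : ∀ v, ∫⁻ ω, ENNReal.ofReal (y v ω) ∂μ ≤ ENNReal.ofReal K) :
    ∫⁻ ω, ENNReal.ofReal (a * y₀ ω + b * ∑ v, y v ω) ∂μ ≤ ENNReal.ofReal ((a + b * r) * K) := by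
  have e : ∀ ω, ENNReal.ofReal (a * y₀ ω + b * ∑ v, y v ω)
      = ENNReal.ofReal a * ENNReal.ofReal (y₀ ω)
        + ENNReal.ofReal b * ∑ v, ENNReal.ofReal (y v ω) := by
    intro ω
    have hs : 0 ≤ ∑ v, y v ω := Finset.sum_nonneg fun v _ => hy v ω
    rw [ENNReal.ofReal_add (mul_nonneg ha (hy₀ ω)) (mul_nonneg hb hs), ENNReal.ofReal_mul ha,
      ENNReal.ofReal_mul hb, ENNReal.ofReal_sum_of_nonneg fun v _ => hy v ω]
  simp_rw [e]
  rw [lintegral_add_left (by fun_prop), lintegral_const_mul _ (by fun_prop),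
    lintegral_const_mul _ (by fun_prop), lintegral_finsetSum _ (by fun_prop)]
  calc _ ≤ ENNReal.ofReal a * ENNReal.ofReal K
        + ENNReal.ofReal b * ∑ _v : Fin r, ENNReal.ofReal K := by
        gcongr with v; exact h v
    _ = _ := by
        rw [← ENNReal.ofReal_sum_of_nonneg fun _ _ => hK, ← ENNReal.ofReal_mul ha,
          ← ENNReal.ofReal_mul hb, ← ENNReal.ofReal_add (by positivity) (by simp; positivity)]
        congr 1
        simp
        ring

/-- One-step moment estimate for an Euler–Maruyama step with coercive drift `f₁`, delayed drift
`f₂` of linear growth and diffusion `g`. -/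
theorem exists_eulerStep_moment_le {Ω : Type*} [MeasurableSpace Ω] (μ : Measure Ω)
    [IsProbabilityMeasure μ] (r : ℕ) {q L D c : ℝ} (hq : 1 ≤ q) (hL : 0 ≤ L) (hD : 0 ≤ D)
    (hc : 0 ≤ c) :
    ∃ κ : ℝ, 0 ≤ κ ∧ ∀ (δ K : ℝ) (x f₁ f₂ g W : Ω → ℝ) (Y : Fin r → Ω → ℝ),
      0 ≤ δ → δ ≤ 1 → 0 ≤ K →
      Measurable x → Measurable f₁ → Measurable f₂ → Measurable g → Measurable W →
      (∀ v, Measurable (Y v)) →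
      IndepFun (fun ω => (x ω + (f₁ ω + f₂ ω) * δ, g ω)) W μ →
      μ.map W = gaussianReal 0 δ.toNNReal →
      (∀ ω, x ω * f₁ ω + (2 * q - 1) / 2 * g ω ^ 2 ≤ 2 * L * (1 + x ω ^ 2)) →
      (∀ ω, f₁ ω ^ 2 * δ ≤ 4 * D ^ 2) →
      (∀ ω, g ω ^ 2 * δ ≤ D ^ 2) → (∀ ω, g ω ^ 4 * δ ≤ D ^ 4) →
      (∀ ω, f₂ ω ^ 2 ≤ c * ∑ v, (1 + Y v ω ^ 2)) →
      ∫⁻ ω, ENNReal.ofReal ((1 + x ω ^ 2) ^ q) ∂μ ≤ ENNReal.ofReal K →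
      (∀ v, ∫⁻ ω, ENNReal.ofReal ((1 + Y v ω ^ 2) ^ q) ∂μ ≤ ENNReal.ofReal K) →
      ∫⁻ ω, ENNReal.ofReal ((1 + (x ω + (f₁ ω + f₂ ω) * δ + g ω * W ω) ^ 2) ^ q) ∂μ
        ≤ ENNReal.ofReal (Real.exp (κ * δ) * K) := by
  obtain ⟨C, hC, H⟩ := exists_lintegral_one_add_sq_rpow_gaussianReal_le hq hD
  set c₁ : ℝ := 4 * L + 1 + 8 * D ^ 2 + 3 * c with hc₁
  have hc₁0 : 0 ≤ c₁ := by positivity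
  refine ⟨C + c₁ * (1 + r) * q, by positivity, ?_⟩
  intro δ K x f₁ f₂ g W Y hδ0 hδ1 hK hx hf₁ hf₂ hg hW hY hind hlaw hcoer hb₁ hg2 hg4 hb₂ h₀ h
  have hA : Measurable fun ω => x ω + (f₁ ω + f₂ ω) * δ := by fun_prop
  set w : ℝ := 1 + c₁ * (1 + r) * δ with hw
  have hw0 : 0 < w := by positivity
  refine (lintegral_one_add_sq_rpow_add_mul_le (q := q)
    (F := fun a g => ENNReal.ofReal ((1 + C * δ) * (1 + a ^ 2 + (2 * q - 1) * (g ^ 2 * δ)) ^ q))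
    hA hg hW hind hlaw (fun ω => H _ _ _ hδ0 (hg2 ω) (hg4 ω))).trans ?_
  have hpt : ∀ ω, (1 + C * δ) * (1 + (x ω + (f₁ ω + f₂ ω) * δ) ^ 2
      + (2 * q - 1) * (g ω ^ 2 * δ)) ^ q
      ≤ ((1 + C * δ) * w ^ (q - 1) * (1 + c₁ * δ)) * (1 + x ω ^ 2) ^ q
        + ((1 + C * δ) * w ^ (q - 1) * (c₁ * δ)) * ∑ v, (1 + Y v ω ^ 2) ^ q := by
    intro ω
    have hS : 0 ≤ ∑ v, (1 + Y v ω ^ 2) := Finset.sum_nonneg fun v _ => by positivity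
    have h1 := one_add_sq_drift_le hδ0 hδ1 (hcoer ω) (hb₁ ω) (hb₂ ω)
    have h2 : (1 + (4 * L + 1 + 8 * D ^ 2) * δ) * (1 + x ω ^ 2)
        + 3 * δ * (c * ∑ v, (1 + Y v ω ^ 2))
        ≤ (1 + c₁ * δ) * (1 + x ω ^ 2) + c₁ * δ * ∑ v, (1 + Y v ω ^ 2) := by
      have e1 : 0 ≤ c * δ * (1 + x ω ^ 2) := by positivity
      have e2 : 0 ≤ (4 * L + 1 + 8 * D ^ 2) * δ * ∑ v, (1 + Y v ω ^ 2) := by positivity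
      rw [hc₁]
      linear_combination 3 * e1 + e2
    have h3 := rpow_weighted_sum_le (y₀ := 1 + x ω ^ 2) (y := fun v => 1 + Y v ω ^ 2) hq hc₁0 hδ0
      (by positivity) (fun v => by positivity)
    have h4 : 0 ≤ 1 + (x ω + (f₁ ω + f₂ ω) * δ) ^ 2 + (2 * q - 1) * (g ω ^ 2 * δ) := by
      have : 0 ≤ 2 * q - 1 := by linarith
      positivity
    have h5 := (Real.rpow_le_rpow h4 (h1.trans h2) (by linarith : 0 ≤ q)).trans h3
    have h6 := mul_le_mul_of_nonneg_left h5 (by positivity : 0 ≤ 1 + C * δ)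
    refine h6.trans (le_of_eq ?_)
    rw [hw]; ring
  refine (lintegral_mono fun ω => ENNReal.ofReal_le_ofReal (hpt ω)).trans ?_
  refine (lintegral_weighted_sum_le (by positivity) (by positivity) hK (by fun_prop)
    (by fun_prop) (fun ω => by positivity) (fun v ω => by positivity) h₀ h).trans ?_
  refine ENNReal.ofReal_le_ofReal ?_
  gcongr
  have e1 : (1 + C * δ) * w ^ (q - 1) * (1 + c₁ * δ) + (1 + C * δ) * w ^ (q - 1) * (c₁ * δ) * r
      = (1 + C * δ) * w ^ q := by
    rw [Real.rpow_sub_one hw0.ne']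
    field_simp
    rw [hw]; ring
  rw [e1, add_mul C _ δ, Real.exp_add]
  gcongr
  · linarith [Real.add_one_le_exp (C * δ)]
  · calc w ^ q ≤ (Real.exp (c₁ * (1 + r) * δ)) ^ q := by
          apply Real.rpow_le_rpow hw0.le _ (by linarith)
          linarith [Real.add_one_le_exp (c₁ * (1 + r) * δ)]
      _ = _ := by rw [← Real.exp_mul]; ring_nf

theorem continuous_of_abs_sub_le_polynomial {f : ℝ → ℝ} {L l σ : ℝ} (hl : 0 ≤ l) (hσ : 0 < σ)
    (hf : ∀ x y : ℝ, |f x - f y| ≤ L * (1 + |x| ^ l + |y| ^ l) * |x - y| ^ σ) :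
    Continuous f := by
  rw [continuous_iff_continuousAt]
  intro y
  have hc : Continuous fun x : ℝ => L * (1 + |x| ^ l + |y| ^ l) * |x - y| ^ σ := by
    have h1 : Continuous fun x : ℝ => |x| ^ l := continuous_abs.rpow_const fun _ => Or.inr hl
    have h2 : Continuous fun x : ℝ => |x - y| ^ σ :=
      (by fun_prop : Continuous fun x : ℝ => |x - y|).rpow_const fun _ => Or.inr hσ.le
    fun_prop
  rw [ContinuousAt, tendsto_iff_dist_tendsto_zero]
  have ht := hc.tendsto y
  simp only [sub_self, abs_zero, Real.zero_rpow hσ.ne', mul_zero] at ht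
  exact squeeze_zero (fun _ => dist_nonneg) (fun x => by rw [Real.dist_eq]; exact hf x y) ht

theorem continuous_of_abs_sub_le_sum {r : ℕ} {f : (Fin r → ℝ) → ℝ} {L : ℝ}
    (hf : ∀ m n : Fin r → ℝ, |f m - f n| ≤ L * ∑ i, |m i - n i|) : Continuous f := by
  rw [continuous_iff_continuousAt]
  intro y
  have hc : Continuous fun x : Fin r → ℝ => L * ∑ i, |x i - y i| := by fun_prop
  rw [ContinuousAt, tendsto_iff_dist_tendsto_zero]
  have ht := hc.tendsto y
  simp only [sub_self, abs_zero, Finset.sum_const_zero, mul_zero] at ht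
  exact squeeze_zero (fun _ => dist_nonneg) (fun x => by rw [Real.dist_eq]; exact hf x y) ht

theorem sq_le_mul_sum_one_add_sq {r : ℕ} (hr : 0 < r) {f : (Fin r → ℝ) → ℝ} {L : ℝ}
    (hf : ∀ m n : Fin r → ℝ, |f m - f n| ≤ L * ∑ i, |m i - n i|) (m : Fin r → ℝ) :
    f m ^ 2 ≤ (2 * f 0 ^ 2 + 2 * L ^ 2 * r) * ∑ v, (1 + m v ^ 2) := by
  have h1 := hf m 0
  simp only [Pi.zero_apply, sub_zero] at h1
  have h2 : (f m - f 0) ^ 2 ≤ (L * ∑ i, |m i|) ^ 2 := by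
    rw [← sq_abs (f m - f 0)]
    gcongr
  have h3 : (∑ i, |m i|) ^ 2 ≤ r * ∑ i, m i ^ 2 := by
    simpa using sq_sum_le_card_mul_sum_sq (s := Finset.univ) (f := fun i => |m i|)
  have h4 : f m ^ 2 ≤ 2 * f 0 ^ 2 + 2 * (f m - f 0) ^ 2 := by nlinarith [sq_nonneg (f m - 2 * f 0)]
  have hS : 0 ≤ ∑ i, m i ^ 2 := Finset.sum_nonneg fun i _ => sq_nonneg _
  have hr1 : (1 : ℝ) ≤ r := by exact_mod_cast hr
  rw [Finset.sum_add_distrib]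
  simp only [Finset.sum_const, Finset.card_univ, Fintype.card_fin, nsmul_eq_mul, mul_one]
  have h5 : L ^ 2 * (∑ i, |m i|) ^ 2 ≤ L ^ 2 * (r * ∑ i, m i ^ 2) := by gcongr
  have h6 : f 0 ^ 2 * 1 ≤ f 0 ^ 2 * r := by gcongr
  have h7 : 0 ≤ f 0 ^ 2 * ∑ i, m i ^ 2 := by positivity
  have h8 : 0 ≤ L ^ 2 * r * r := by positivity
  rw [mul_pow] at h2
  linear_combination h4 + 2 * h2 + 2 * h5 + 2 * h6 + 2 * h7 + 2 * h8

theorem abs_truncation_le {R : ℝ} (hR : 0 ≤ R) (x : ℝ) :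
    |if x = 0 then 0 else min |x| R * (x / |x|)| ≤ R := by
  split_ifs with h
  · simpa using hR
  · have hx : 0 < |x| := abs_pos.2 h
    rw [abs_mul, abs_div, abs_abs, div_self hx.ne', mul_one, abs_of_nonneg (le_min hx.le hR)]
    exact min_le_right _ _

/-- Truncating the argument of the coefficients preserves the Khasminskii-type condition. -/
theorem truncation_coercive {a b : ℝ → ℝ} {L s R : ℝ} (hL : 0 ≤ L) (hs : 0 ≤ s) (hR : 1 ≤ R)
    (hab : ∀ x : ℝ, x * a x + s * |b x| ^ 2 ≤ L * (1 + x ^ 2)) {y x : ℝ}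
    (hy : y = if x = 0 then 0 else min |x| R * (x / |x|)) :
    x * a y + s * b y ^ 2 ≤ 2 * L * (1 + x ^ 2) := by
  simp only [sq_abs] at hab
  have hx2 : 0 ≤ L * (1 + x ^ 2) := by positivity
  rcases le_total |x| R with h | h
  · have : y = x := by
      rw [hy]
      split_ifs with h0
      · exact h0.symm
      · rw [min_eq_left h, mul_div_cancel₀ _ (abs_pos.2 h0).ne']
    rw [this]
    linarith [hab x]
  · have hx0 : x ≠ 0 := by
      rintro rfl
      simp at h; linarith
    rw [if_neg hx0, min_eq_right h] at hy
    have hxp : 0 < |x| := abs_pos.2 hx0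
    have hR0 : 0 < R := by linarith
    have hρ1 : 1 ≤ |x| / R := (one_le_div hR0).2 h
    have hxy : x = |x| / R * y := by rw [hy]; field_simp
    have hy2 : y ^ 2 = R ^ 2 := by
      rw [hy, mul_pow, div_pow, sq_abs, div_self (by positivity), mul_one]
    have h1 := mul_le_mul_of_nonneg_left (hab y) (by linarith : 0 ≤ |x| / R)
    have h2 : s * b y ^ 2 ≤ |x| / R * (s * b y ^ 2) :=
      le_mul_of_one_le_left (by positivity) hρ1
    have h3 : |x| / R * (1 + y ^ 2) ≤ 2 * (1 + x ^ 2) := by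
      rw [hy2]
      have e1 : |x| / R * (1 + R ^ 2) = |x| / R + |x| * R := by field_simp
      have e2 : |x| / R ≤ |x| := div_le_self hxp.le hR
      have e3 : |x| * R ≤ |x| * |x| := by gcongr
      rw [e1]
      nlinarith [sq_abs x, sq_nonneg (|x| - 1)]
    have h4 := mul_le_mul_of_nonneg_left h3 hL
    have h5 : x * a y = |x| / R * (y * a y) := by
      conv_lhs => rw [hxy]
      ring
    rw [h5]
    linarith

theorem integral_le_of_lintegral_ofReal_le {Ω : Type*} [MeasurableSpace Ω] {μ : Measure Ω}
    {f : Ω → ℝ} {C : ℝ} (hC : 0 ≤ C)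
    (h : ∫⁻ ω, ENNReal.ofReal (f ω) ∂μ ≤ ENNReal.ofReal C) : ∫ ω, f ω ∂μ ≤ C := by
  by_cases hf : Integrable f μ
  · rw [integral_eq_lintegral_pos_part_sub_lintegral_neg_part hf]
    have := ENNReal.toReal_le_of_le_ofReal hC h
    linarith [ENNReal.toReal_nonneg (a := ∫⁻ ω, ENNReal.ofReal (-f ω) ∂μ)]
  · rw [integral_undef hf]; exact hC

/-- Moment bound for the continuous truncated Euler–Maruyama approximation
(Lemma 3.3, first part): under Assumptions A1–A4 and the conditions on `h`, `Γ`,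
for every `p ∈ (0, p̌]` there is a constant `C > 0`, independent of `Δ` and `t`,
such that `E|χ(t)|^p ≤ C` for all admissible `Δ ∈ (0,1]` and `t ∈ [0,T]`. -/
theorem truncatedEM_moment_bound
    -- probability space and Brownian motion
    {Ω : Type*} [MeasurableSpace Ω] (μ : Measure Ω) [IsProbabilityMeasure μ]
    (B : ℝ → Ω → ℝ)
    (hB0 : ∀ᵐ ω ∂μ, B 0 ω = 0)
    (hBcont : ∀ ω, Continuous fun t => B t ω)
    (hBmeas : ∀ t, Measurable (B t))
    (hBgauss : ∀ s t : ℝ, 0 ≤ s → s ≤ t →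
      Measure.map (fun ω => B t ω - B s ω) μ = gaussianReal 0 (Real.toNNReal (t - s)))
    (hBindep : ∀ s t : ℝ, 0 ≤ s → s ≤ t →
      IndepFun (fun ω => B t ω - B s ω) (fun ω (u : Set.Icc (0:ℝ) s) => B (u : ℝ) ω) μ)
    -- coefficients
    (r : ℕ) (hr : 0 < r)
    (α₁ α₂ β : ℝ → ℝ) (α₃ : (Fin r → ℝ) → ℝ)
    -- Assumption A1
    (L₁ l₁ η : ℝ) (hL₁ : 0 < L₁) (hl₁ : 1 ≤ l₁) (hη : η ∈ Set.Ioo (0 : ℝ) 1)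
    (hA1a : ∀ x y : ℝ, |α₁ x - α₁ y| ≤ L₁ * (1 + |x| ^ l₁ + |y| ^ l₁) * |x - y| ^ η)
    (hA1b : ∀ x y : ℝ, (x - y) * (α₂ x - α₂ y) ≤ L₁ * |x - y| ^ 2)
    (hA1c : ∀ m n : Fin r → ℝ, |α₃ m - α₃ n| ≤ L₁ * ∑ i, |m i - n i|)
    (hα₁cont : Continuous α₁)
    (hα₁anti : ∀ x y : ℝ, x ≤ y → α₁ y ≤ α₁ x)
    -- Assumption A2
    (Lbar₂ pp : ℝ) (hLbar₂ : 0 < Lbar₂) (hpp : 2 ≤ pp)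
    (hA2 : ∀ x : ℝ, x * (α₁ x + α₂ x) + (pp - 1) / 2 * |β x| ^ 2 ≤ Lbar₂ * (1 + x ^ 2))
    -- Assumption A3
    (L₃ σ l₂ l₃ : ℝ) (hL₃ : 0 < L₃) (hσ : σ ∈ Set.Ico (1/2 : ℝ) 1)
    (hl₂ : 1 ≤ l₂) (hl₃ : 1 ≤ l₃)
    (hA3a : ∀ x y : ℝ, |α₂ x - α₂ y| ≤ L₃ * (1 + |x| ^ l₂ + |y| ^ l₂) * |x - y|)
    (hA3b : ∀ x y : ℝ, |β x - β y| ≤ L₃ * (1 + |x| ^ l₃ + |y| ^ l₃) * |x - y| ^ σ)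
    -- delays and initial data (Assumption A4)
    (τ : Fin r → ℝ) (τmax : ℝ)
    (hτ0 : τ ⟨0, hr⟩ = 0) (hτmono : StrictMono τ)
    (hτtop : τ ⟨r - 1, by omega⟩ = τmax)
    (ξ : ℝ → ℝ) (L₄ γ : ℝ) (hL₄ : 0 < L₄) (hγ : γ ∈ Set.Ioc (0 : ℝ) 1)
    (hA4 : ∀ s ∈ Set.Icc (-τmax) (0:ℝ), ∀ t ∈ Set.Icc (-τmax) (0:ℝ),
      |ξ t - ξ s| ≤ L₄ * |t - s| ^ γ)
    -- truncation data
    (h : ℝ → ℝ)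
    (hmono : StrictMonoOn h (Set.Ioi (0 : ℝ)))
    (hcont : ContinuousOn h (Set.Ioi (0 : ℝ)))
    (htop : Filter.Tendsto h Filter.atTop Filter.atTop)
    (hbound : ∀ w : ℝ, 1 ≤ w → ∀ x : ℝ, |x| ≤ w →
      max (max |α₁ x| |α₂ x|) |β x| ≤ h w)
    (hinv : ℝ → ℝ)
    (hinv_spec : ∀ y : ℝ, h 1 ≤ y → 1 ≤ hinv y ∧ h (hinv y) = y)
    (Γ : ℝ → ℝ) (L₀ : ℝ)
    (hΓanti : StrictAntiOn Γ (Set.Ioc (0 : ℝ) 1))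
    (hΓtop : Filter.Tendsto Γ (nhdsWithin 0 (Set.Ioi (0:ℝ))) Filter.atTop)
    (hΓle : ∀ Δ ∈ Set.Ioc (0 : ℝ) 1, Δ ^ ((1:ℝ)/4) * Γ Δ ≤ L₀)
    (hΓge : ∀ Δ ∈ Set.Ioc (0 : ℝ) 1, h 1 ≤ Γ Δ)
    (π : ℝ → ℝ → ℝ)
    (hπ : ∀ Δ x : ℝ, π Δ x =
      if x = 0 then 0 else min |x| (hinv (Γ Δ)) * (x / |x|))
    -- horizon and exponent
    (T : ℝ) (hT : 0 < T)
    (p : ℝ) (hp : p ∈ Set.Ioc (0 : ℝ) pp) :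
    ∃ C > (0 : ℝ),
      ∀ Δ ∈ Set.Ioc (0 : ℝ) 1, ∀ MT : ℕ, 0 < MT → Δ = T / MT →
      ∀ k : Fin r → ℕ, (∀ v : Fin r, τ v = (k v : ℝ) * Δ) →
      ∀ X : ℤ → Ω → ℝ, ∀ χ : ℝ → Ω → ℝ,
        -- initial values of the scheme
        (∀ j : ℤ, -((k ⟨r - 1, by omega⟩ : ℕ) : ℤ) ≤ j → j ≤ 0 →
          ∀ ω, X j ω = ξ ((j : ℝ) * Δ)) →
        -- discrete truncated EM recursion
        (∀ j : ℕ, j < MT → ∀ ω, X ((j : ℤ) + 1) ω =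
          X (j : ℤ) ω
            + (α₁ (π Δ (X (j : ℤ) ω)) + α₂ (π Δ (X (j : ℤ) ω))
                + α₃ (fun v => X ((j : ℤ) - (k v : ℤ)) ω)) * Δ
            + β (π Δ (X (j : ℤ) ω)) * (B (((j : ℝ) + 1) * Δ) ω - B ((j : ℝ) * Δ) ω)) →
        -- continuous version of the scheme
        (∀ j : ℕ, j < MT → ∀ t ∈ Set.Icc ((j : ℝ) * Δ) (((j : ℝ) + 1) * Δ), ∀ ω,
          χ t ω = X (j : ℤ) ω
            + (α₁ (π Δ (X (j : ℤ) ω)) + α₂ (π Δ (X (j : ℤ) ω))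
                + α₃ (fun v => X ((j : ℤ) - (k v : ℤ)) ω)) * (t - (j : ℝ) * Δ)
            + β (π Δ (X (j : ℤ) ω)) * (B t ω - B ((j : ℝ) * Δ) ω)) →
        ∀ t ∈ Set.Icc (0 : ℝ) T, (∫ ω, |χ t ω| ^ p ∂μ) ≤ C := by
  obtain ⟨hp0, hpp'⟩ := hp
  obtain ⟨q, rfl⟩ : ∃ q : ℝ, pp = 2 * q := ⟨pp / 2, by ring⟩
  have hq : 1 ≤ q := by linarith
  have hα₂cont : Continuous α₂ :=
    continuous_of_abs_sub_le_polynomial (by linarith : 0 ≤ l₂) one_pos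
      (fun x y => by simpa using hA3a x y)
  have hβcont : Continuous β :=
    continuous_of_abs_sub_le_polynomial (by linarith : 0 ≤ l₃) (by linarith [hσ.1]) hA3b
  have hα₃cont : Continuous α₃ := continuous_of_abs_sub_le_sum hA1c
  have hh1 : 0 ≤ h 1 :=
    (abs_nonneg _).trans ((le_max_right _ _).trans (hbound 1 le_rfl 0 (by simp)))
  have hL₀ : 0 ≤ L₀ := by
    have h1 := hΓle 1 (by simp)
    have h2 := hΓge 1 (by simp)
    rw [Real.one_rpow, one_mul] at h1
    linarith
  set lastI : Fin r := ⟨r - 1, by omega⟩ with hlastI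
  have hτmax : 0 ≤ τmax := by
    rw [← hτ0, ← hτtop]
    exact hτmono.monotone (by simp [Fin.le_def])
  obtain ⟨κ, hκ, hstep⟩ := exists_eulerStep_moment_le μ r hq hLbar₂.le hL₀
    (by positivity : 0 ≤ 2 * α₃ 0 ^ 2 + 2 * L₁ ^ 2 * r)
  set M : ℝ := |ξ 0| + L₄ * τmax ^ γ with hM
  set K₀ : ℝ := (1 + M ^ 2) ^ q with hK₀
  have hK₀pos : 0 < K₀ := by positivity
  refine ⟨Real.exp (κ * T) * K₀, by positivity, ?_⟩
  intro Δ hΔ MT hMT hΔT k hk X χ hX0 hXrec hχ t ht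
  have hΔ0 : 0 < Δ := hΔ.1
  have hΔ1 : Δ ≤ 1 := hΔ.2
  have hMT0 : (0 : ℝ) < MT := by exact_mod_cast hMT
  have hTΔ : T = MT * Δ := by rw [hΔT]; field_simp
  have hkle : ∀ v, k v ≤ k lastI := by
    intro v
    have h1 : τ v ≤ τ lastI := hτmono.monotone (by simp [Fin.le_def, hlastI]; omega)
    rw [hk, hk] at h1
    exact_mod_cast le_of_mul_le_mul_right h1 hΔ0
  -- bounds and measurability of the truncated coefficients
  have hR1 : 1 ≤ hinv (Γ Δ) := (hinv_spec _ (hΓge Δ hΔ)).1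
  have hhR : h (hinv (Γ Δ)) = Γ Δ := (hinv_spec _ (hΓge Δ hΔ)).2
  have hΓ0 : 0 ≤ Γ Δ := hh1.trans (hΓge Δ hΔ)
  have hcoef : ∀ x, |α₁ (π Δ x)| ≤ Γ Δ ∧ |α₂ (π Δ x)| ≤ Γ Δ ∧ |β (π Δ x)| ≤ Γ Δ := by
    intro x
    have h1 : |π Δ x| ≤ hinv (Γ Δ) := by
      rw [hπ]; exact abs_truncation_le (by linarith) x
    have h2 := hbound _ hR1 _ h1
    rw [hhR] at h2
    exact ⟨(le_max_left _ _).trans ((le_max_left _ _).trans h2),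
      (le_max_right _ _).trans ((le_max_left _ _).trans h2), (le_max_right _ _).trans h2⟩
  have hπmeas : Measurable (π Δ) := by
    rw [funext (hπ Δ)]
    exact Measurable.ite (measurableSet_singleton 0) measurable_const (by fun_prop)
  have hdrift : Measurable fun x => α₁ (π Δ x) + α₂ (π Δ x) :=
    (hα₁cont.measurable.comp hπmeas).add (hα₂cont.measurable.comp hπmeas)
  have hdiff : Measurable fun x => β (π Δ x) := hβcont.measurable.comp hπmeas
  have hΔΓ : Γ Δ ^ 2 * Δ ≤ L₀ ^ 2 ∧ Γ Δ ^ 4 * Δ ≤ L₀ ^ 4 := by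
    set e : ℝ := Δ ^ ((1 : ℝ) / 4) with he
    have he0 : 0 ≤ e := Real.rpow_nonneg hΔ0.le _
    have he1 : e ≤ 1 := Real.rpow_le_one hΔ0.le hΔ1 (by norm_num)
    have he4 : e ^ 4 = Δ := by
      rw [he, ← Real.rpow_natCast, ← Real.rpow_mul hΔ0.le]; norm_num
    have h1 : e * Γ Δ ≤ L₀ := hΓle Δ hΔ
    have h2 : (e * Γ Δ) ^ 2 ≤ L₀ ^ 2 := by gcongr
    have h4 : (e * Γ Δ) ^ 4 ≤ L₀ ^ 4 := by gcongr
    constructor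
    · calc Γ Δ ^ 2 * Δ = (e * Γ Δ) ^ 2 * e ^ 2 := by rw [← he4]; ring
        _ ≤ (e * Γ Δ) ^ 2 * 1 := by gcongr; exact pow_le_one₀ he0 he1
        _ ≤ _ := by linarith
    · calc Γ Δ ^ 4 * Δ = (e * Γ Δ) ^ 4 := by rw [← he4]; ring
        _ ≤ _ := h4
  -- adaptedness of the scheme
  let ℱ : ℝ → MeasurableSpace Ω := fun s =>
    MeasurableSpace.comap (fun ω (u : Set.Icc (0 : ℝ) s) => B (u : ℝ) ω) MeasurableSpace.pi
  have hℱle : ∀ s, ℱ s ≤ ‹MeasurableSpace Ω› := fun s => by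
    have h1 : Measurable fun ω (u : Set.Icc (0 : ℝ) s) => B (u : ℝ) ω :=
      measurable_pi_lambda _ fun u => hBmeas u
    exact h1.comap_le
  have hBℱ : ∀ s u, 0 ≤ u → u ≤ s → Measurable[ℱ s] (B u) := by
    intro s u h0 h1
    exact (measurable_pi_apply (⟨u, h0, h1⟩ : Set.Icc (0 : ℝ) s)).comp
      (comap_measurable (fun ω (u : Set.Icc (0 : ℝ) s) => B (u : ℝ) ω))
  have hXconst : ∀ (m : MeasurableSpace Ω) (i : ℤ), -(k lastI : ℤ) ≤ i → i ≤ 0 →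
      Measurable[m] (X i) := by
    intro m i h1 h2
    rw [show X i = fun _ => ξ ((i : ℝ) * Δ) from funext (hX0 i h1 h2)]
    exact measurable_const
  have hα₃meas : ∀ (m : MeasurableSpace Ω) (j : ℕ),
      (∀ i : ℤ, -(k lastI : ℤ) ≤ i → i ≤ j → Measurable[m] (X i)) →
      Measurable[m] fun ω => α₃ (fun v => X ((j : ℤ) - (k v : ℤ)) ω) := by
    intro m j hm
    refine hα₃cont.measurable.comp (measurable_pi_lambda _ fun v => hm _ ?_ ?_)
    · have := hkle v; omega
    · omega
  have hadapt : ∀ (s : ℝ) (n : ℕ), n ≤ MT → (n : ℝ) * Δ ≤ s →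
      ∀ i : ℤ, -(k lastI : ℤ) ≤ i → i ≤ n → Measurable[ℱ s] (X i) := by
    intro s n
    induction n with
    | zero => intro _ _ i h1 h2; exact hXconst _ i h1 (by simpa using h2)
    | succ n ih =>
      intro hn hs i h1 h2
      have hs' : (n : ℝ) * Δ ≤ s := by push_cast at hs; nlinarith
      have ih' := ih (by omega) hs'
      rcases lt_or_eq_of_le h2 with h3 | h3
      · exact ih' i h1 (by push_cast at h3; omega)
      · have hXn := ih' n (by omega) le_rfl
        have hα := hα₃meas (ℱ s) n ih'
        have hB1 := hBℱ s (((n : ℝ) + 1) * Δ) (by positivity) (by push_cast at hs; exact hs)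
        have hB2 := hBℱ s ((n : ℝ) * Δ) (by positivity) hs'
        rw [h3]
        push_cast
        rw [funext (hXrec n (by omega))]
        exact (hXn.add (((hdrift.comp hXn).add hα).mul_const Δ)).add
          ((hdiff.comp hXn).mul (hB1.sub hB2))
  -- the one-step estimate for the scheme
  have hχstep : ∀ j : ℕ, j < MT → ∀ s ∈ Set.Icc ((j : ℝ) * Δ) (((j : ℝ) + 1) * Δ), ∀ K : ℝ, 0 ≤ K →
      (∀ i : ℤ, -(k lastI : ℤ) ≤ i → i ≤ j →
        ∫⁻ ω, ENNReal.ofReal ((1 + X i ω ^ 2) ^ q) ∂μ ≤ ENNReal.ofReal K) →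
      ∫⁻ ω, ENNReal.ofReal ((1 + χ s ω ^ 2) ^ q) ∂μ
        ≤ ENNReal.ofReal (Real.exp (κ * (s - (j : ℝ) * Δ)) * K) := by
    intro j hj s hs K hK hbd
    set δ : ℝ := s - (j : ℝ) * Δ with hδ
    have hδ0 : 0 ≤ δ := by linarith [hs.1]
    have hδΔ : δ ≤ Δ := by linarith [hs.2]
    have hjΔ : 0 ≤ (j : ℝ) * Δ := by positivity
    have hmj := hadapt ((j : ℝ) * Δ) j hj.le le_rfl
    have hXj := hmj j (by omega) le_rfl
    have hαj := hα₃meas _ j hmj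
    have hΓδ2 : Γ Δ ^ 2 * δ ≤ L₀ ^ 2 := le_trans (by gcongr) hΔΓ.1
    have hΓδ4 : Γ Δ ^ 4 * δ ≤ L₀ ^ 4 := le_trans (by gcongr) hΔΓ.2
    have hpair : Measurable[ℱ ((j : ℝ) * Δ)] fun ω =>
        (X j ω + ((α₁ (π Δ (X j ω)) + α₂ (π Δ (X j ω)))
          + α₃ (fun v => X ((j : ℤ) - (k v : ℤ)) ω)) * δ, β (π Δ (X j ω))) :=
      (hXj.add (((hdrift.comp hXj).add hαj).mul_const δ)).prodMk (hdiff.comp hXj)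
    have hind : IndepFun (fun ω =>
        (X j ω + ((α₁ (π Δ (X j ω)) + α₂ (π Δ (X j ω)))
          + α₃ (fun v => X ((j : ℤ) - (k v : ℤ)) ω)) * δ, β (π Δ (X j ω))))
        (fun ω => B s ω - B ((j : ℝ) * Δ) ω) μ := by
      have h1 := (hBindep ((j : ℝ) * Δ) s hjΔ hs.1).symm
      rw [IndepFun_iff_Indep] at h1 ⊢
      exact indep_of_indep_of_le_left h1 hpair.comap_le
    have hXj' : Measurable (X j) := hXj.mono (hℱle _) le_rfl
    have hres := hstep δ K (X j) (fun ω => α₁ (π Δ (X j ω)) + α₂ (π Δ (X j ω)))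
      (fun ω => α₃ (fun v => X ((j : ℤ) - (k v : ℤ)) ω)) (fun ω => β (π Δ (X j ω)))
      (fun ω => B s ω - B ((j : ℝ) * Δ) ω) (fun v ω => X ((j : ℤ) - (k v : ℤ)) ω)
      hδ0 (hδΔ.trans hΔ1) hK hXj' (hdrift.comp hXj') (hαj.mono (hℱle _) le_rfl)
      (hdiff.comp hXj') ((hBmeas _).sub (hBmeas _))
      (fun v => (hmj _ (by have := hkle v; omega) (by omega)).mono (hℱle _) le_rfl)
      hind (hBgauss _ _ hjΔ hs.1)
      (fun ω => truncation_coercive (a := fun x => α₁ x + α₂ x) hLbar₂.le (by linarith) hR1 hA2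
        (hπ Δ (X j ω)))
      (fun ω => by
        have h1 : |α₁ (π Δ (X j ω)) + α₂ (π Δ (X j ω))| ≤ 2 * Γ Δ :=
          (abs_add_le _ _).trans (by linarith [(hcoef (X j ω)).1, (hcoef (X j ω)).2.1])
        have h2 : (α₁ (π Δ (X j ω)) + α₂ (π Δ (X j ω))) ^ 2 ≤ (2 * Γ Δ) ^ 2 := by
          rw [← sq_abs]; gcongr
        have h3 := mul_le_mul_of_nonneg_right h2 hδ0
        linarith)
      (fun ω => by
        have h2 : β (π Δ (X j ω)) ^ 2 ≤ Γ Δ ^ 2 := by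
          rw [← sq_abs]; gcongr; exact (hcoef (X j ω)).2.2
        exact (mul_le_mul_of_nonneg_right h2 hδ0).trans hΓδ2)
      (fun ω => by
        have h2 : β (π Δ (X j ω)) ^ 4 ≤ Γ Δ ^ 4 := by
          rw [← (by decide : Even 4).pow_abs]; gcongr; exact (hcoef (X j ω)).2.2
        exact (mul_le_mul_of_nonneg_right h2 hδ0).trans hΓδ4)
      (fun ω => sq_le_mul_sum_one_add_sq hr hA1c _)
      (hbd j (by omega) le_rfl)
      (fun v => hbd _ (by have := hkle v; omega) (by omega))
    refine le_trans (le_of_eq ?_) hres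
    refine lintegral_congr fun ω => ?_
    rw [hχ j hj s hs ω]
  -- moment bound on the grid
  have hgrid : ∀ n : ℕ, n ≤ MT → ∀ i : ℤ, -(k lastI : ℤ) ≤ i → i ≤ n →
      ∫⁻ ω, ENNReal.ofReal ((1 + X i ω ^ 2) ^ q) ∂μ
        ≤ ENNReal.ofReal (Real.exp (κ * ((n : ℝ) * Δ)) * K₀) := by
    intro n
    induction n with
    | zero =>
      intro _ i h1 h2
      have h2' : i ≤ 0 := by simpa using h2
      have hi0 : (i : ℝ) ≤ 0 := by exact_mod_cast h2'
      have hik : -(k lastI : ℝ) ≤ (i : ℝ) := by exact_mod_cast h1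
      have hτk : τmax = (k lastI : ℝ) * Δ := by rw [← hτtop, ← hk]
      have hmem : (i : ℝ) * Δ ∈ Set.Icc (-τmax) 0 := by
        constructor
        · rw [hτk]; nlinarith
        · exact mul_nonpos_of_nonpos_of_nonneg hi0 hΔ0.le
      have h3 := hA4 0 ⟨by linarith, le_rfl⟩ _ hmem
      have h4 : |ξ ((i : ℝ) * Δ)| ≤ M := by
        have h5 : |(i : ℝ) * Δ - 0| ^ γ ≤ τmax ^ γ := by
          refine Real.rpow_le_rpow (abs_nonneg _) ?_ hγ.1.le
          rw [sub_zero, abs_of_nonpos hmem.2]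
          linarith [hmem.1]
        have h6 := mul_le_mul_of_nonneg_left h5 hL₄.le
        have h7 := abs_sub_abs_le_abs_sub (ξ ((i : ℝ) * Δ)) (ξ 0)
        rw [hM]; linarith
      calc ∫⁻ ω, ENNReal.ofReal ((1 + X i ω ^ 2) ^ q) ∂μ ≤ ∫⁻ _, ENNReal.ofReal K₀ ∂μ := by
            refine lintegral_mono fun ω => ENNReal.ofReal_le_ofReal ?_
            rw [hX0 i h1 h2' ω, hK₀, ← sq_abs (ξ _)]
            gcongr
        _ = _ := by simp
    | succ n ih =>
      intro hn i h1 h2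
      have ih' := ih (by omega)
      have hexp : Real.exp (κ * Δ) * (Real.exp (κ * ((n : ℝ) * Δ)) * K₀)
          = Real.exp (κ * (((n + 1 : ℕ) : ℝ) * Δ)) * K₀ := by
        rw [← mul_assoc, ← Real.exp_add]
        congr 2
        push_cast; ring
      rcases lt_or_eq_of_le h2 with h3 | h3
      · refine (ih' i h1 (by push_cast at h3; omega)).trans (ENNReal.ofReal_le_ofReal ?_)
        gcongr
        simp
      · have hmem : ((n : ℝ) + 1) * Δ ∈ Set.Icc ((n : ℝ) * Δ) (((n : ℝ) + 1) * Δ) :=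
          ⟨by linarith, le_rfl⟩
        have h4 := hχstep n (by omega) _ hmem _ (by positivity) ih'
        rw [show ((n : ℝ) + 1) * Δ - n * Δ = Δ by ring, hexp] at h4
        refine le_trans (le_of_eq ?_) h4
        refine lintegral_congr fun ω => ?_
        rw [h3]
        push_cast
        rw [hXrec n (by omega) ω, hχ n (by omega) _ hmem ω,
          show ((n : ℝ) + 1) * Δ - n * Δ = Δ by ring]
  -- conclusion at an arbitrary time
  obtain ⟨j, hj, hjt⟩ : ∃ j : ℕ, j < MT ∧ t ∈ Set.Icc ((j : ℝ) * Δ) (((j : ℝ) + 1) * Δ) := by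
    rcases eq_or_lt_of_le ht.1 with h0 | h0
    · exact ⟨0, hMT, by rw [← h0]; simp [hΔ0.le]⟩
    · have hn : 0 < ⌈t / Δ⌉₊ := Nat.ceil_pos.2 (by positivity)
      have hnM : ⌈t / Δ⌉₊ ≤ MT := by
        rw [Nat.ceil_le, div_le_iff₀ hΔ0, ← hTΔ]; exact ht.2
      obtain ⟨j, hj⟩ := Nat.exists_eq_succ_of_ne_zero hn.ne'
      refine ⟨j, by omega, ?_, ?_⟩
      · have : (j : ℝ) < t / Δ := Nat.lt_ceil.1 (by omega)
        exact ((lt_div_iff₀ hΔ0).1 this).le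
      · have : t / Δ ≤ (⌈t / Δ⌉₊ : ℝ) := Nat.le_ceil _
        rw [hj, div_le_iff₀ hΔ0] at this
        simpa using this
  have hfin := hχstep j hj t hjt _ (by positivity) (hgrid j hj.le)
  rw [← mul_assoc, ← Real.exp_add] at hfin
  have hexp : Real.exp (κ * (t - j * Δ) + κ * (j * Δ)) * K₀ ≤ Real.exp (κ * T) * K₀ := by
    rw [← mul_add, sub_add_cancel]
    gcongr
    exact ht.2
  have hlin : ∫⁻ ω, ENNReal.ofReal (|χ t ω| ^ p) ∂μ ≤ ENNReal.ofReal (Real.exp (κ * T) * K₀) := by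
    refine (lintegral_mono fun ω => ENNReal.ofReal_le_ofReal ?_).trans
      (hfin.trans (ENNReal.ofReal_le_ofReal hexp))
    have h1 : |χ t ω| ^ p = (χ t ω ^ 2) ^ (p / 2) := by
      rw [← sq_abs, ← Real.rpow_natCast, ← Real.rpow_mul (abs_nonneg _)]
      congr 1; push_cast; ring
    rw [h1]
    calc (χ t ω ^ 2) ^ (p / 2) ≤ (1 + χ t ω ^ 2) ^ (p / 2) :=
          Real.rpow_le_rpow (sq_nonneg _) (by linarith) (by linarith)
      _ ≤ _ := Real.rpow_le_rpow_of_exponent_le (by linarith [sq_nonneg (χ t ω)]) (by linarith)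
  refine integral_le_of_lintegral_ofReal_le ?_ hlin
  positivity
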